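/- Let V be a nonempty finite type and k ≥ 2. Let P be a probability mass function on V^k with marginals P_t, and for each t ∈ {1, …, k} define the hybrid distribution Q^{(t)} on V^k by Q^{(t)}(y_1, …, y_k) = P(y_1, …, y_t) · Π_{j=t+1}^{k} P_j(y_j). Then for every t ∈ {2, …, k}, TV(Q^{(t)}, Q^{(t−1)}) = Σ_{y_{<t}} P(y_{<t}) · TV(P(· | y_{<t}), P_t), i.e. the total variation distance between consecutive hybrids equals the expectation, over histories Y_{<t} drawn from P, of the total variation distance between the conditional distribution of the t-th coordinate given the history and its marginal. -/

import Mathlib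

open Finset

/-- Total variation distance between two mass functions on a finite type:
`TV(p, q) = (1/2) ∑ₓ |p x - q x|`. -/
noncomputable def tv {X : Type*} [Fintype X] (p q : X → ℝ) : ℝ :=
  (1 / 2) * ∑ x, |p x - q x|

/-- The `t`-th marginal of a mass function `P` on `Fin k → V`. -/
noncomputable def marg {V : Type*} [Fintype V] [DecidableEq V] {k : ℕ}
    (P : (Fin k → V) → ℝ) (t : Fin k) (v : V) : ℝ :=
  ∑ y : Fin k → V, if y t = v then P y else 0

/-- Probability under `P` that the first `t` coordinates agree with those of `z`. -/
noncomputable def prefProb {V : Type*} [Fintype V] [DecidableEq V] {k : ℕ}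
    (P : (Fin k → V) → ℝ) (t : ℕ) (z : Fin k → V) : ℝ :=
  ∑ y : Fin k → V, if ∀ i : Fin k, (i : ℕ) < t → y i = z i then P y else 0

/-- Conditional distribution of coordinate `t` given that the coordinates before `t`
equal those of `z` (Lean's division-by-zero convention handles zero-probability
histories, which are anyway weighted by zero below). -/
noncomputable def condD {V : Type*} [Fintype V] [DecidableEq V] {k : ℕ}
    (P : (Fin k → V) → ℝ) (t : Fin k) (z : Fin k → V) (v : V) : ℝ :=
  prefProb P ((t : ℕ) + 1) (Function.update z t v) / prefProb P (t : ℕ) z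

/-- Extend a history on the first `t` coordinates to a full configuration. -/
noncomputable def extendHist {V : Type*} [Nonempty V] {k t : ℕ}
    (h : Fin t → V) : Fin k → V :=
  fun i => if hi : (i : ℕ) < t then h ⟨i, hi⟩ else Classical.arbitrary V

/-- Expectation, over histories `Y_{<t}` drawn from `P`, of the total variation
distance between the conditional distribution of the `t`-th coordinate given the
history and the `t`-th marginal. -/
noncomputable def expCondTV {V : Type*} [Fintype V] [DecidableEq V] [Nonempty V] {k : ℕ}
    (P : (Fin k → V) → ℝ) (t : Fin k) : ℝ :=
  ∑ h : Fin (t : ℕ) → V,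
    prefProb P (t : ℕ) (extendHist h) * tv (condD P t (extendHist h)) (marg P t)

/-- The hybrid distribution `Q^{(t)}`: joint under `P` on the first `t` coordinates,
independent marginals on the remaining coordinates. -/
noncomputable def hybrid {V : Type*} [Fintype V] [DecidableEq V] {k : ℕ}
    (P : (Fin k → V) → ℝ) (t : ℕ) (y : Fin k → V) : ℝ :=
  prefProb P t y * ∏ j ∈ univ.filter (fun j : Fin k => t ≤ (j : ℕ)), marg P j (y j)

section HybridDistributions

variable {V : Type*} {k : ℕ}

/-- A configuration on the coordinates up to `t` is a history before `t` together with the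
value at `t`. -/
noncomputable def historyEquiv [Nonempty V] (t : Fin k) :
    ({j : Fin k // j ≤ t} → V) ≃ (Fin (t : ℕ) → V) × V where
  toFun a := (fun i => a ⟨⟨i, i.2.trans t.2⟩, Fin.le_def.2 i.2.le⟩, a ⟨t, le_rfl⟩)
  invFun x := fun j => Function.update (extendHist x.1) t x.2 j
  left_inv a := by
    funext ⟨j, hj⟩
    rcases hj.lt_or_eq with h | rfl
    · have h' : (j : ℕ) < t := h
      simp [Function.update_of_ne h.ne, extendHist, h']
    · simp
  right_inv x := by
    ext i
    · have h : (⟨i, i.2.trans t.2⟩ : Fin k) ≠ t := Fin.ne_of_lt i.2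
      simp [Function.update_of_ne h, extendHist]
    · simp

variable [Fintype V]

/-- Coordinates after `t` that are independent with total mass one can be summed out. -/
lemma sum_mul_prod_eq_sum_history [Nonempty V] (t : Fin k) (G : (Fin k → V) → ℝ)
    (hG : ∀ z w : Fin k → V, (∀ i ≤ t, z i = w i) → G z = G w)
    (m : Fin k → V → ℝ) (hm : ∀ j, ∑ v, m j v = 1) :
    ∑ y, G y * ∏ j ∈ univ.filter (fun j : Fin k => (t : ℕ) + 1 ≤ (j : ℕ)), m j (y j) =
      ∑ h : Fin (t : ℕ) → V, ∑ v, G (Function.update (extendHist h) t v) := by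
  have hsum : ∑ b : {j : Fin k // ¬ j ≤ t} → V, ∏ j : {j : Fin k // ¬ j ≤ t}, m j (b j) = 1 := by
    rw [← Fintype.prod_sum]
    simp [hm]
  let e := (Equiv.piEquivPiSubtypeProd (fun j : Fin k => j ≤ t) (fun _ => V)).trans
    ((historyEquiv t).prodCongr (Equiv.refl _))
  rw [← Fintype.sum_prod_type', ← Equiv.sum_comp e.symm, Fintype.sum_prod_type]
  refine Finset.sum_congr rfl fun x _ => ?_
  have hterm (b : {j : Fin k // ¬ j ≤ t} → V) :
      G (e.symm (x, b)) * ∏ j ∈ univ.filter (fun j : Fin k => (t : ℕ) + 1 ≤ (j : ℕ)),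
          m j (e.symm (x, b) j) =
        G (Function.update (extendHist x.1) t x.2) * ∏ j : {j : Fin k // ¬ j ≤ t}, m j (b j) := by
    congr 1
    · refine hG _ _ fun i hi => ?_
      simp [e, historyEquiv, Equiv.piEquivPiSubtypeProd, hi]
    · rw [Finset.prod_subtype (p := fun j => ¬ j ≤ t) _
        (fun j => by simp)]
      refine Finset.prod_congr rfl fun j _ => ?_
      simp [e, Equiv.piEquivPiSubtypeProd, j.2]
  simp_rw [hterm]
  rw [← Finset.mul_sum, hsum, mul_one]

variable [DecidableEq V]

lemma sum_marg (P : (Fin k → V) → ℝ) (t : Fin k) : ∑ v, marg P t v = ∑ y, P y := by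
  unfold marg
  rw [Finset.sum_comm]
  simp

lemma marg_nonneg {P : (Fin k → V) → ℝ} (hP : ∀ y, 0 ≤ P y) (t : Fin k) (v : V) :
    0 ≤ marg P t v :=
  Finset.sum_nonneg fun y _ => by split_ifs <;> simp [hP]

lemma prefProb_nonneg {P : (Fin k → V) → ℝ} (hP : ∀ y, 0 ≤ P y) (t : ℕ) (z : Fin k → V) :
    0 ≤ prefProb P t z :=
  Finset.sum_nonneg fun y _ => by split_ifs <;> simp [hP]

lemma prefProb_congr (P : (Fin k → V) → ℝ) {t : ℕ} {z w : Fin k → V}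
    (h : ∀ i : Fin k, (i : ℕ) < t → z i = w i) : prefProb P t z = prefProb P t w := by
  unfold prefProb
  refine Finset.sum_congr rfl fun y _ => ?_
  have : (∀ i : Fin k, (i : ℕ) < t → y i = z i) ↔ ∀ i : Fin k, (i : ℕ) < t → y i = w i :=
    forall₂_congr fun _ hi => by rw [h _ hi]
  simp only [this]

lemma prefProb_succ_le {P : (Fin k → V) → ℝ} (hP : ∀ y, 0 ≤ P y) (t : ℕ) (z : Fin k → V) :
    prefProb P (t + 1) z ≤ prefProb P t z := by
  unfold prefProb
  refine Finset.sum_le_sum fun y _ => ?_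
  by_cases h : ∀ i : Fin k, (i : ℕ) < t + 1 → y i = z i
  · rw [if_pos h, if_pos fun i hi => h i (by omega)]
  · rw [if_neg h]
    split_ifs <;> simp [hP]

lemma prefProb_update (P : (Fin k → V) → ℝ) (t : Fin k) (z : Fin k → V) (v : V) :
    prefProb P t (Function.update z t v) = prefProb P t z :=
  prefProb_congr P fun i hi => Function.update_of_ne (Fin.ne_of_lt hi) _ _

lemma hybrid_succ_sub_hybrid (P : (Fin k → V) → ℝ) (t : Fin k) (y : Fin k → V) :
    hybrid P ((t : ℕ) + 1) y - hybrid P t y =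
      (prefProb P ((t : ℕ) + 1) y - prefProb P t y * marg P t (y t)) *
        ∏ j ∈ univ.filter (fun j : Fin k => (t : ℕ) + 1 ≤ (j : ℕ)), marg P j (y j) := by
  have hfilter : univ.filter (fun j : Fin k => (t : ℕ) ≤ (j : ℕ)) =
      insert t (univ.filter (fun j : Fin k => (t : ℕ) + 1 ≤ (j : ℕ))) := by
    ext j
    simp only [mem_filter, mem_univ, true_and, mem_insert, Fin.ext_iff]
    omega
  unfold hybrid
  rw [hfilter, Finset.prod_insert (by simp)]
  ring

lemma prefProb_mul_condD {P : (Fin k → V) → ℝ} (hP : ∀ y, 0 ≤ P y) (t : Fin k)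
    (z : Fin k → V) (v : V) :
    prefProb P t z * condD P t z v = prefProb P ((t : ℕ) + 1) (Function.update z t v) := by
  unfold condD
  refine mul_div_cancel_of_imp' fun h => le_antisymm ?_ (prefProb_nonneg hP _ _)
  rw [← h, ← prefProb_update P t z v]
  exact prefProb_succ_le hP _ _

end HybridDistributions

/-- Equations 12–15 in the paper's proof of Theorem 1. For each
position `t` (0-indexed, `1 ≤ t`, i.e. `t ∈ {2,…,k}` in the paper's 1-indexed
notation), the total variation distance between consecutive hybrid distributions
`Q^{(t+1)}` and `Q^{(t)}` equals the expectation, over histories drawn from `P`, of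
the total variation distance between the conditional distribution of the `t`-th
coordinate given the history and its marginal. -/
theorem stmt2 {V : Type*} [Fintype V] [DecidableEq V] [Nonempty V] {k : ℕ} (hk : 2 ≤ k)
    (P : (Fin k → V) → ℝ) (hP0 : ∀ y, 0 ≤ P y) (hP1 : ∑ y, P y = 1) :
    ∀ t : Fin k, 1 ≤ (t : ℕ) →
      tv (hybrid P ((t : ℕ) + 1)) (hybrid P (t : ℕ)) = expCondTV P t := by
  intro t _
  unfold expCondTV tv
  have habs (y : Fin k → V) : |hybrid P ((t : ℕ) + 1) y - hybrid P t y| =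
      |prefProb P ((t : ℕ) + 1) y - prefProb P t y * marg P t (y t)| *
        ∏ j ∈ univ.filter (fun j : Fin k => (t : ℕ) + 1 ≤ (j : ℕ)), marg P j (y j) := by
    rw [hybrid_succ_sub_hybrid, abs_mul,
      abs_of_nonneg (Finset.prod_nonneg fun j _ => marg_nonneg hP0 j (y j))]
  simp_rw [habs]
  rw [sum_mul_prod_eq_sum_history t
    (fun y => |prefProb P ((t : ℕ) + 1) y - prefProb P t y * marg P t (y t)|) ?_
    (marg P) (fun j => (sum_marg P j).trans hP1), Finset.mul_sum]
  · refine Finset.sum_congr rfl fun h _ => ?_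
    rw [mul_left_comm, Finset.mul_sum univ _ (prefProb P t (extendHist h))]
    congr 1
    refine Finset.sum_congr rfl fun v _ => ?_
    rw [prefProb_update, Function.update_self, ← prefProb_mul_condD hP0, ← mul_sub, abs_mul,
      abs_of_nonneg (prefProb_nonneg hP0 _ _)]
  · intro z w hzw
    have hsucc := prefProb_congr P (t := (t : ℕ) + 1) (z := z) (w := w)
      fun i hi => hzw i (Fin.le_def.2 (by omega))
    have hpre := prefProb_congr P (t := (t : ℕ)) (z := z) (w := w)
      fun i hi => hzw i (Fin.le_def.2 (by omega))
    simp only [hsucc, hpre, hzw t le_rfl]
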